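/- arXiv:1603.01733 — 2 statements merged into one kernel-verified Lean document; each statement's English description precedes it below -/
import Mathlib

section
/- Consider the Misra–Gries algorithm run with k counters on a stream a_1, …, a_m of items from {1, …, n}. For every item i ∈ {1, …, n}, the final stored count ĉ_i satisfies f_i ≥ ĉ_i ≥ f_i − m/k. In particular, if k ≥ 1/ε for a parameter 0 < ε < 1, then ĉ_i ≥ f_i − εm. -/
/-- One step of the Misra–Gries algorithm with `k` counters: the state is the
function assigning to each item its currently stored count (`0` if the item is
not in the table). -/
def mgStep (n k : ℕ) (c : Fin n → ℕ) (a : Fin n) : Fin n → ℕ :=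
  if 0 < c a then Function.update c a (c a + 1)
  else if (Finset.univ.filter fun x => 0 < c x).card < k then Function.update c a 1
  else fun x => c x - 1

/-- The final table of the Misra–Gries algorithm with `k` counters after
processing the stream `s`, starting from the empty table. -/
def mgRun (n k : ℕ) (s : List (Fin n)) : Fin n → ℕ :=
  s.foldl (mgStep n k) (fun _ => 0)

/-- Decrementing every stored count lowers the total by the number of stored items. -/
theorem sum_sub_one_add_card_pos {ι : Type*} [Fintype ι] (c : ι → ℕ) :
    ∑ x, (c x - 1) + (Finset.univ.filter fun x => 0 < c x).card = ∑ x, c x := by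
  rw [Finset.card_filter, ← Finset.sum_add_distrib]
  refine Finset.sum_congr rfl fun x _ => ?_
  split_ifs <;> omega

theorem sum_update_succ {ι : Type*} [Fintype ι] [DecidableEq ι] (c : ι → ℕ) (a : ι) :
    ∑ x, Function.update c a (c a + 1) x = ∑ x, c x + 1 := by
  rw [Finset.sum_update_of_mem (Finset.mem_univ a),
    ← Finset.add_sum_erase _ c (Finset.mem_univ a), Finset.sdiff_singleton_eq_erase]
  omega

theorem mgStep_eq (n k : ℕ) (c : Fin n → ℕ) (a : Fin n) :
    mgStep n k c a = Function.update c a (c a + 1) ∨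
      c a = 0 ∧ k ≤ (Finset.univ.filter fun x => 0 < c x).card ∧
        mgStep n k c a = fun x => c x - 1 := by
  unfold mgStep
  split_ifs with h₁ h₂
  · exact Or.inl rfl
  · left
    rw [Nat.eq_zero_of_not_pos h₁]
  · exact Or.inr ⟨Nat.eq_zero_of_not_pos h₁, not_lt.mp h₂, rfl⟩

/-- The invariant of the algorithm; `d` is the number of decrement steps. -/
theorem exists_mgRun_bounds (n k : ℕ) (s : List (Fin n)) :
    ∃ d, k * d + ∑ x, mgRun n k s x ≤ s.length ∧
      ∀ i, mgRun n k s i ≤ s.count i ∧ s.count i ≤ mgRun n k s i + d := by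
  induction s using List.reverseRecOn with
  | nil => exact ⟨0, by simp [mgRun]⟩
  | append_singleton s a ih =>
    obtain ⟨d, hsum, hd⟩ := ih
    have hrun : mgRun n k (s ++ [a]) = mgStep n k (mgRun n k s) a := by simp [mgRun]
    rw [hrun]
    have hcount (i : Fin n) : (s ++ [a]).count i = s.count i + if a = i then 1 else 0 := by
      simp [List.count_append, List.count_singleton]
    simp only [hcount, List.length_append, List.length_singleton]
    generalize mgRun n k s = c at *
    rcases mgStep_eq n k c a with h | ⟨ha, hk, h⟩
    · rw [h]
      refine ⟨d, by rw [sum_update_succ]; omega, fun i => ?_⟩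
      have := hd i
      rcases eq_or_ne a i with rfl | hne
      · simp only [Function.update_self, if_true]
        omega
      · simp only [Function.update_of_ne hne.symm, if_neg hne]
        omega
    · rw [h]
      refine ⟨d + 1, ?_, fun i => ?_⟩
      · have := sum_sub_one_add_card_pos c
        rw [mul_add_one]
        beta_reduce
        omega
      · have := hd i
        rcases eq_or_ne a i with rfl | hne
        · simp only [if_true]
          omega
        · simp only [if_neg hne]
          omega

/-- For every item `i`, the final Misra–Gries count `ĉ_i` satisfies
`f_i ≥ ĉ_i ≥ f_i − m/k`; in particular, if `k ≥ 1/ε` with `0 < ε < 1`,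
then `ĉ_i ≥ f_i − ε·m`. -/
theorem misra_gries_count_bounds (n k : ℕ) (hk : 1 ≤ k) (s : List (Fin n)) (i : Fin n) :
    mgRun n k s i ≤ s.count i ∧
    (s.count i : ℝ) - (s.length : ℝ) / (k : ℝ) ≤ (mgRun n k s i : ℝ) ∧
    ∀ ε : ℝ, 0 < ε → ε < 1 → 1 / ε ≤ (k : ℝ) →
      (s.count i : ℝ) - ε * (s.length : ℝ) ≤ (mgRun n k s i : ℝ) := by
  obtain ⟨d, hsum, hd⟩ := exists_mgRun_bounds n k s
  obtain ⟨hle, hge⟩ := hd i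
  have hk0 : (0 : ℝ) < k := by exact_mod_cast hk
  have hge' : (s.count i : ℝ) ≤ mgRun n k s i + d := by exact_mod_cast hge
  have hdk : (d : ℝ) ≤ s.length / k := by
    rw [le_div_iff₀ hk0, mul_comm]
    exact_mod_cast (Nat.le_add_right _ _).trans hsum
  refine ⟨hle, by linarith, fun ε hε _ hεk => ?_⟩
  have hdε : (s.length : ℝ) / k ≤ ε * s.length := by
    rw [div_le_iff₀ hk0]
    have : 1 ≤ k * ε := (div_le_iff₀ hε).mp hεk
    nlinarith [(Nat.cast_nonneg s.length : (0 : ℝ) ≤ s.length)]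
  linarith
end

section
/- Let a_1, …, a_m be a stream of items from {1, …, n}, let 0 < ε < 1, and let r = 400/ε² with r/m ≤ 1. Let Z_1, …, Z_m be pairwise independent {0,1}-valued random variables, each equal to 1 with probability r/m, and for each item i ∈ {1, …, n} let f̂_i = Σ_{j : a_j = i} Z_j be the number of sampled occurrences of i. Then with probability at least 99/100, simultaneously for every item i ∈ {1, …, n}, |f̂_i/r − f_i/m| ≤ ε/2, where f_i denotes the number of occurrences of i in the stream. -/
open MeasureTheory ProbabilityTheory

/-- A random variable with values in `{0, 1}` is square-integrable. -/
lemma memLp_two_of_zero_or_one {Ω : Type*} [MeasurableSpace Ω] {μ : Measure Ω}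
    [IsFiniteMeasure μ] {X : Ω → ℝ} (hX : Measurable X) (hvals : ∀ ω, X ω = 0 ∨ X ω = 1) :
    MemLp X 2 μ := by
  refine MemLp.of_bound hX.aestronglyMeasurable 1 (ae_of_all _ fun ω => ?_)
  rcases hvals ω with h | h <;> simp [h]

/-- The expectation of a `{0, 1}`-valued random variable is the probability of the value `1`. -/
lemma integral_eq_measureReal_of_zero_or_one {Ω : Type*} [MeasurableSpace Ω] {μ : Measure Ω}
    {X : Ω → ℝ} (hX : Measurable X) (hvals : ∀ ω, X ω = 0 ∨ X ω = 1) :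
    ∫ ω, X ω ∂μ = μ.real {ω | X ω = 1} := by
  have hX_eq : X = {ω | X ω = 1}.indicator 1 := by
    ext ω
    rcases hvals ω with h | h <;> simp [Set.indicator, h]
  conv_lhs => rw [hX_eq]
  exact integral_indicator_one (hX (measurableSet_singleton 1))

/-- The variance of a `{0, 1}`-valued random variable is at most its expectation. -/
lemma variance_le_measureReal_of_zero_or_one {Ω : Type*} [MeasurableSpace Ω] {μ : Measure Ω}
    [IsProbabilityMeasure μ] {X : Ω → ℝ} (hX : Measurable X)
    (hvals : ∀ ω, X ω = 0 ∨ X ω = 1) :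
    Var[X; μ] ≤ μ.real {ω | X ω = 1} := by
  have hsq : X ^ 2 = X := by
    ext ω
    rcases hvals ω with h | h <;> simp [h]
  have h := variance_le_expectation_sq (μ := μ) hX.aestronglyMeasurable
  rwa [hsq, integral_eq_measureReal_of_zero_or_one hX hvals] at h

/-- Chebyshev's inequality for a sum of pairwise independent Bernoulli variables. -/
lemma measure_le_abs_sum_bernoulli_sub_le {Ω ι : Type*} [MeasurableSpace Ω] {μ : Measure Ω}
    [IsProbabilityMeasure μ] {Z : ι → Ω → ℝ} {p c : ℝ} (s : Finset ι)
    (hmeas : ∀ j, Measurable (Z j)) (hvals : ∀ j ω, Z j ω = 0 ∨ Z j ω = 1)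
    (hprob : ∀ j, μ.real {ω | Z j ω = 1} = p)
    (hindep : Pairwise fun j j' => IndepFun (Z j) (Z j') μ) (hc : 0 < c) :
    μ {ω | c ≤ |∑ j ∈ s, Z j ω - s.card * p|} ≤ ENNReal.ofReal (s.card * p / c ^ 2) := by
  have hL2 (j : ι) : MemLp (Z j) 2 μ := memLp_two_of_zero_or_one (hmeas j) (hvals j)
  have hmean : μ[∑ j ∈ s, Z j] = s.card * p := by
    simp only [Finset.sum_apply]
    rw [integral_finsetSum _ fun j _ => (hL2 j).integrable one_le_two]
    simp [integral_eq_measureReal_of_zero_or_one (hmeas _) (hvals _), hprob]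
  have hvar : Var[∑ j ∈ s, Z j; μ] ≤ s.card * p := by
    rw [IndepFun.variance_sum (fun j _ => hL2 j) fun j _ j' _ h => hindep h, ← nsmul_eq_mul]
    exact Finset.sum_le_card_nsmul _ _ _ fun j _ =>
      (variance_le_measureReal_of_zero_or_one (hmeas j) (hvals j)).trans_eq (hprob j)
  have hcheb := meas_ge_le_variance_div_sq (memLp_finsetSum' s fun j _ => hL2 j) hc
  rw [hmean] at hcheb
  simp only [Finset.sum_apply] at hcheb
  exact hcheb.trans (ENNReal.ofReal_le_ofReal (by gcongr))

/-- Sampling a stream: if each of the `m` stream positions is sampled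
pairwise-independently with probability `r/m` where `r = 400/ε²`, and
`f̂_i` counts the sampled occurrences of item `i`, then with probability at
least `99/100`, simultaneously for all items `i`,
`|f̂_i/r − f_i/m| ≤ ε/2`. -/
theorem sampled_frequencies_uniformly_close
    {Ω : Type*} [MeasurableSpace Ω] (μ : Measure Ω) [IsProbabilityMeasure μ]
    (n m : ℕ) (hm : 1 ≤ m) (a : Fin m → Fin n)
    (ε r : ℝ) (hε : 0 < ε) (hε1 : ε < 1)
    (hr : r = 400 / ε ^ 2) (hrm : r / (m : ℝ) ≤ 1)
    (Z : Fin m → Ω → ℝ)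
    (hmeas : ∀ j, Measurable (Z j))
    (hvals : ∀ j ω, Z j ω = 0 ∨ Z j ω = 1)
    (hprob : ∀ j, μ {ω | Z j ω = 1} = ENNReal.ofReal (r / (m : ℝ)))
    (hindep : ∀ j j' : Fin m, j ≠ j' → IndepFun (Z j) (Z j') μ)
    (fhat : Fin n → Ω → ℝ)
    (hfhat : ∀ i ω, fhat i ω = ∑ j ∈ Finset.univ.filter (fun j => a j = i), Z j ω) :
    99 / 100 ≤
      μ {ω | ∀ i : Fin n,
        |fhat i ω / r - ((Finset.univ.filter fun j => a j = i).card : ℝ) / (m : ℝ)| ≤ ε / 2} := by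
  have hm0 : (0 : ℝ) < m := by exact_mod_cast hm
  have hr0 : 0 < r := hr ▸ by positivity
  set f : Fin n → Finset (Fin m) := fun i => Finset.univ.filter fun j => a j = i
  have hprob' (j : Fin m) : μ.real {ω | Z j ω = 1} = r / m := by
    rw [measureReal_def, hprob, ENNReal.toReal_ofReal (by positivity)]
  have htail (i : Fin n) :
      μ {ω | ε / 2 < |fhat i ω / r - ((f i).card : ℝ) / m|} ≤
        ENNReal.ofReal ((f i).card / m / 100) := by
    have hcheb := measure_le_abs_sum_bernoulli_sub_le (f i) hmeas hvals hprob' hindep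
      (c := r * (ε / 2)) (by positivity)
    have hbound : (f i).card * (r / m) / (r * (ε / 2)) ^ 2 = ((f i).card : ℝ) / m / 100 := by
      rw [hr]
      field_simp
      ring
    rw [hbound] at hcheb
    refine (measure_mono fun ω hω => ?_).trans hcheb
    have hscale : fhat i ω - (f i).card * (r / m) =
        r * (fhat i ω / r - ((f i).card : ℝ) / m) := by
      field_simp
    rw [Set.mem_ofPred_eq, ← hfhat, hscale, abs_mul, abs_of_pos hr0]
    exact mul_le_mul_of_nonneg_left (le_of_lt hω) hr0.le
  have hcard : ∑ i, ((f i).card : ℝ) = m := by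
    have h := Finset.card_eq_sum_card_fiberwise (f := a) (s := Finset.univ) (t := Finset.univ)
      (by simp)
    rw [Finset.card_univ, Fintype.card_fin] at h
    exact_mod_cast h.symm
  set S : Set Ω := {ω | ∀ i : Fin n, |fhat i ω / r - ((f i).card : ℝ) / m| ≤ ε / 2}
  have hfail : μ Sᶜ ≤ ENNReal.ofReal (1 / 100) := calc
    μ Sᶜ ≤ μ (⋃ i, {ω | ε / 2 < |fhat i ω / r - ((f i).card : ℝ) / m|}) :=
      measure_mono fun ω hω => by simpa [S] using hω
    _ ≤ ∑ i, μ {ω | ε / 2 < |fhat i ω / r - ((f i).card : ℝ) / m|} :=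
      measure_iUnion_fintype_le _ _
    _ ≤ ∑ i, ENNReal.ofReal ((f i).card / m / 100) := Finset.sum_le_sum fun i _ => htail i
    _ = ENNReal.ofReal (1 / 100) := by
      rw [← ENNReal.ofReal_sum_of_nonneg fun i _ => by positivity, ← Finset.sum_div,
        ← Finset.sum_div, hcard, div_self hm0.ne']
  have hreal : (99 / 100 : ENNReal) = 1 - ENNReal.ofReal (1 / 100) := by
    rw [← ENNReal.ofReal_one, ← ENNReal.ofReal_sub _ (by norm_num), show
      (1 - 1 / 100 : ℝ) = 99 / 100 by norm_num, ENNReal.ofReal_div_of_pos (by norm_num)]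
    simp
  rw [hreal, tsub_le_iff_right]
  calc (1 : ENNReal) = μ (S ∪ Sᶜ) := by simp
    _ ≤ μ S + μ Sᶜ := measure_union_le _ _
    _ ≤ μ S + ENNReal.ofReal (1 / 100) := by gcongr
end
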